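/- Let λ: ℝ → (0,∞) satisfy the admissibility condition. If a ∈ BS^m_σ(λ;t) for some t ∈ [0,1], then a†(q,p,q') := conjugate(a(q',p,q)) belongs to BS^m_σ(λ;1−t). Moreover, for a ∈ BS^0_0(λ;t) and all j, k ∈ ℤ, the Hilbert-space adjoint on L²(dq) of the bounded operator ψ_j Op(a) ψ_k satisfies (ψ_j Op(a) ψ_k)* v = ψ_k Op(a†) ψ_j v for every v ∈ C_c^∞(ℝ^n). -/

import Mathlib

open MeasureTheory Real
open scoped BigOperators Classical

noncomputable section

/-- Points of `ℝⁿ`. The coordinate `q 0` plays the role of the radial variable `r`,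
the remaining coordinates are the angular variables `θ`. -/
abbrev Vec (n : ℕ) := Fin n → ℝ

/-- Complex-valued partial derivative in the coordinate direction `i`. -/
def pdC {n : ℕ} (i : Fin n) (f : Vec n → ℂ) : Vec n → ℂ :=
  fun x => fderiv ℝ f x (Pi.single i 1)

/-- Iterated (multiindex) partial derivative `∂^A f`. -/
def mpd {n : ℕ} (A : Fin n → ℕ) (f : Vec n → ℂ) : Vec n → ℂ :=
  (List.finRange n).foldr (fun i g => (pdC i)^[A i] g) f

/-- Real-valued partial derivative in the coordinate direction `i`. -/
def pdR {n : ℕ} (i : Fin n) (f : Vec n → ℝ) : Vec n → ℝ :=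
  fun x => fderiv ℝ f x (Pi.single i 1)

/-- Iterated (multiindex) partial derivative, real valued. -/
def mpdR {n : ℕ} (A : Fin n → ℕ) (f : Vec n → ℝ) : Vec n → ℝ :=
  (List.finRange n).foldr (fun i g => (pdR i)^[A i] g) f

/-- Total length `|A| = α₀ + |α|` of a multiindex. -/
def fullLen {n : ℕ} (A : Fin n → ℕ) : ℕ := ∑ i, A i

/-- Angular length `|α|` of a multiindex `A = (α₀, α)`. -/
def angLen {n : ℕ} [NeZero n] (A : Fin n → ℕ) : ℕ := ∑ i, if i = 0 then 0 else A i

/-- The weighted Japanese bracket `⟨ρ ⊕ μ⁻¹ η⟩ = (1 + ρ² + μ⁻²|η|²)^(1/2)`,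
where `ρ = p 0` and `η` are the remaining coordinates of `p`. -/
def jbr {n : ℕ} [NeZero n] (μ : ℝ) (p : Vec n) : ℝ :=
  Real.sqrt (1 + ∑ i, (if i = 0 then p i else μ⁻¹ * p i) ^ 2)

/-- Derivative `∂_q^A` of a function `a(q, p)` in the first slot. -/
def dqS {n : ℕ} (A : Fin n → ℕ) (a : Vec n → Vec n → ℂ) : Vec n → Vec n → ℂ :=
  fun q p => mpd A (fun x => a x p) q

/-- Derivative `∂_p^B` of a function `a(q, p)` in the second slot. -/
def dpS {n : ℕ} (B : Fin n → ℕ) (a : Vec n → Vec n → ℂ) : Vec n → Vec n → ℂ :=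
  fun q p => mpd B (fun x => a q x) p

/-- Derivative `∂_q^A` of a function `a(q, p, q')` in the first slot. -/
def d1B {n : ℕ} (A : Fin n → ℕ) (a : Vec n → Vec n → Vec n → ℂ) :
    Vec n → Vec n → Vec n → ℂ :=
  fun q p q' => mpd A (fun x => a x p q') q

/-- Derivative `∂_p^B` of a function `a(q, p, q')` in the second slot. -/
def d2B {n : ℕ} (B : Fin n → ℕ) (a : Vec n → Vec n → Vec n → ℂ) :
    Vec n → Vec n → Vec n → ℂ :=
  fun q p q' => mpd B (fun x => a q x q') p

/-- Derivative `∂_{q'}^{A'}` of a function `a(q, p, q')` in the third slot. -/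
def d3B {n : ℕ} (A' : Fin n → ℕ) (a : Vec n → Vec n → Vec n → ℂ) :
    Vec n → Vec n → Vec n → ℂ :=
  fun q p q' => mpd A' (fun x => a q p x) q'

/-- The admissibility condition for the weight `λ : ℝ → (0,∞)`:
`λ` is positive and `C₀⁻¹ ≤ λ(r)/λ(r') ≤ C₀` whenever `|r - r'| ≤ 1`. -/
def Admissible (lam : ℝ → ℝ) : Prop :=
  (∀ r, 0 < lam r) ∧
  ∃ C > 0, ∀ r r' : ℝ, |r - r'| ≤ 1 → C⁻¹ ≤ lam r / lam r' ∧ lam r / lam r' ≤ C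

/-- The symbol class `S^m_σ(λ)`:  `a` is smooth on `ℝ^{2n}` and for all multiindices
`A = (α₀, α)`, `B = (β₀, β)`,
`|(λ(r)⁻¹∂_θ)^α (λ(r)∂_η)^β ∂_r^{α₀} ∂_ρ^{β₀} a(q,p)| ≤ C ⟨ρ ⊕ λ(r)⁻¹η⟩^{m - σ|B|}`.
(The weights `λ(r)^{±1}` commute with the `θ`- and `η`-derivatives, so the weighted
derivative equals `λ(r)^{|β| - |α|}` times the plain mixed partial derivative.) -/
def IsSymbol {n : ℕ} [NeZero n] (lam : ℝ → ℝ) (m σ : ℝ) (a : Vec n → Vec n → ℂ) : Prop :=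
  ContDiff ℝ (⊤ : ℕ∞) (fun x : Vec n × Vec n => a x.1 x.2) ∧
  ∀ A B : Fin n → ℕ, ∃ C > 0, ∀ q p : Vec n,
    lam (q 0) ^ ((angLen B : ℤ) - (angLen A : ℤ)) * ‖dqS A (dpS B a) q p‖
      ≤ C * jbr (lam (q 0)) p ^ (m - σ * (fullLen B : ℝ))

/-- The seminorm `|a|_{λ : M, m, σ}` on the symbol class `S^m_σ(λ)`. -/
def symSeminorm {n : ℕ} [NeZero n] (lam : ℝ → ℝ) (M : ℕ) (m σ : ℝ)
    (a : Vec n → Vec n → ℂ) : ℝ :=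
  ∑ A : Fin n → Fin (M + 1), ∑ B : Fin n → Fin (M + 1),
    if fullLen (fun i => (A i : ℕ)) + fullLen (fun i => (B i : ℕ)) ≤ M then
      ⨆ q : Vec n, ⨆ p : Vec n,
        jbr (lam (q 0)) p ^ (-m + σ * (fullLen (fun i => (B i : ℕ)) : ℝ)) *
          (lam (q 0) ^ ((angLen (fun i => (B i : ℕ)) : ℤ) - (angLen (fun i => (A i : ℕ)) : ℤ)) *
            ‖dqS (fun i => (A i : ℕ)) (dpS (fun i => (B i : ℕ)) a) q p‖)
    else 0

/-- `λ^t_{jk} := λ(tj + (1-t)k)`. -/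
def lamT (lam : ℝ → ℝ) (t : ℝ) (j k : ℤ) : ℝ := lam (t * j + (1 - t) * k)

/-- The bisymbol class `BS^m_σ(λ; t)`. -/
def IsBisymbol {n : ℕ} [NeZero n] (lam : ℝ → ℝ) (m σ t : ℝ)
    (a : Vec n → Vec n → Vec n → ℂ) : Prop :=
  ContDiff ℝ (⊤ : ℕ∞) (fun x : Vec n × Vec n × Vec n => a x.1 x.2.1 x.2.2) ∧
  ∀ A B A' : Fin n → ℕ, ∃ C > 0, ∀ (j k : ℤ) (q p q' : Vec n),
    |q 0 - (j : ℝ)| ≤ 1 → |q' 0 - (k : ℝ)| ≤ 1 →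
    lamT lam t j k ^ ((angLen B : ℤ) - (angLen A : ℤ) - (angLen A' : ℤ)) *
        ‖d1B A (d2B B (d3B A' a)) q p q'‖
      ≤ C * jbr (lamT lam t j k) p ^ (m - σ * (fullLen B : ℝ))

/-- The seminorm `|a|_{λ : M, m, σ, t}` on `BS^m_σ(λ; t)`. -/
def bisymSeminorm {n : ℕ} [NeZero n] (lam : ℝ → ℝ) (M : ℕ) (m σ t : ℝ)
    (a : Vec n → Vec n → Vec n → ℂ) : ℝ :=
  ∑ A : Fin n → Fin (M + 1), ∑ B : Fin n → Fin (M + 1), ∑ A' : Fin n → Fin (M + 1),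
    if fullLen (fun i => (A i : ℕ)) + fullLen (fun i => (B i : ℕ))
        + fullLen (fun i => (A' i : ℕ)) ≤ M then
      ⨆ j : ℤ, ⨆ k : ℤ, ⨆ q : Vec n, ⨆ p : Vec n, ⨆ q' : Vec n,
        if |q 0 - (j : ℝ)| ≤ 1 ∧ |q' 0 - (k : ℝ)| ≤ 1 then
          jbr (lamT lam t j k) p ^ (-m + σ * (fullLen (fun i => (B i : ℕ)) : ℝ)) *
            (lamT lam t j k ^ ((angLen (fun i => (B i : ℕ)) : ℤ)
                - (angLen (fun i => (A i : ℕ)) : ℤ) - (angLen (fun i => (A' i : ℕ)) : ℤ)) *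
              ‖d1B (fun i => (A i : ℕ)) (d2B (fun i => (B i : ℕ))
                  (d3B (fun i => (A' i : ℕ)) a)) q p q'‖)
        else 0
    else 0

/-- The plain bisymbol class `BS^m_σ(1)` (the case `λ ≡ 1`). -/
def IsBisymbolOne {n : ℕ} [NeZero n] (m σ : ℝ) (a : Vec n → Vec n → Vec n → ℂ) : Prop :=
  ContDiff ℝ (⊤ : ℕ∞) (fun x : Vec n × Vec n × Vec n => a x.1 x.2.1 x.2.2) ∧
  ∀ A B A' : Fin n → ℕ, ∃ C > 0, ∀ q p q' : Vec n,
    ‖d1B A (d2B B (d3B A' a)) q p q'‖ ≤ C * jbr 1 p ^ (m - σ * (fullLen B : ℝ))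

/-- The seminorm `|a|_{M, m, σ}` on `BS^m_σ(1)`. -/
def bisymSeminormOne {n : ℕ} [NeZero n] (M : ℕ) (m σ : ℝ)
    (a : Vec n → Vec n → Vec n → ℂ) : ℝ :=
  ∑ A : Fin n → Fin (M + 1), ∑ B : Fin n → Fin (M + 1), ∑ A' : Fin n → Fin (M + 1),
    if fullLen (fun i => (A i : ℕ)) + fullLen (fun i => (B i : ℕ))
        + fullLen (fun i => (A' i : ℕ)) ≤ M then
      ⨆ q : Vec n, ⨆ p : Vec n, ⨆ q' : Vec n,
        jbr 1 p ^ (-m + σ * (fullLen (fun i => (B i : ℕ)) : ℝ)) *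
          ‖d1B (fun i => (A i : ℕ)) (d2B (fun i => (B i : ℕ))
              (d3B (fun i => (A' i : ℕ)) a)) q p q'‖
    else 0

/-- The oscillatory phase `e^{i p · (q - q')}`. -/
def phase {n : ℕ} (p q q' : Vec n) : ℂ :=
  Complex.exp (Complex.I * ((∑ i, p i * (q i - q' i) : ℝ) : ℂ))

/-- The pseudodifferential operator `Op^g(a)` with bisymbol `a`, as an iterated integral:
`Op^g(a)u(q) = (2π)^{-n} g(q)^{-1/4} ∫ dp ∫ dq' a(q,p,q') e^{ip⋅(q-q')} u(q') g(q')^{1/4}`. -/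
def OpG {n : ℕ} (g : Vec n → ℝ) (a : Vec n → Vec n → Vec n → ℂ) (u : Vec n → ℂ) :
    Vec n → ℂ :=
  fun q => (((2 * Real.pi) ^ (-(n : ℤ)) : ℝ) : ℂ) * ((g q ^ (-(1 : ℝ) / 4) : ℝ) : ℂ) *
    ∫ p : Vec n, ∫ q' : Vec n,
      a q p q' * phase p q q' * u q' * ((g q' ^ ((1 : ℝ) / 4) : ℝ) : ℂ)

/-- The pseudodifferential operator `Op(a) = Op^1(a)` with bisymbol `a`. -/
def Op {n : ℕ} (a : Vec n → Vec n → Vec n → ℂ) (u : Vec n → ℂ) : Vec n → ℂ :=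
  fun q => (((2 * Real.pi) ^ (-(n : ℤ)) : ℝ) : ℂ) *
    ∫ p : Vec n, ∫ q' : Vec n, a q p q' * phase p q q' * u q'

/-- The `t`-quantization `Op^{g,t}(a)` of a symbol `a`. -/
def OpSt {n : ℕ} (g : Vec n → ℝ) (t : ℝ) (a : Vec n → Vec n → ℂ) (u : Vec n → ℂ) :
    Vec n → ℂ :=
  OpG g (fun q p q' => a (t • q + (1 - t) • q') p) u

/-- The quantization `Op(b)` of a symbol `b` (the case `t = 1`, `g ≡ 1`). -/
def OpSym {n : ℕ} (b : Vec n → Vec n → ℂ) (u : Vec n → ℂ) : Vec n → ℂ :=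
  Op (fun q p _ => b q p) u

/-- The `L²(g^{1/2}dq)` norm. -/
def L2g {n : ℕ} (g : Vec n → ℝ) (f : Vec n → ℂ) : ℝ :=
  Real.sqrt (∫ q : Vec n, ‖f q‖ ^ 2 * Real.sqrt (g q))

/-- The `L²(dq)` norm. -/
def L2 {n : ℕ} (f : Vec n → ℂ) : ℝ :=
  Real.sqrt (∫ q : Vec n, ‖f q‖ ^ 2)

end

/-- The directional derivative of `f` along the constant vector field `v`. -/
noncomputable def dirDeriv {E : Type*} [NormedAddCommGroup E] [NormedSpace ℝ E] (v : E)
    (f : E → ℂ) : E → ℂ :=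
  fun x => fderiv ℝ f x v

/-- The iterated directional derivative along the images under `L` of the coordinate vectors. -/
noncomputable def iterDirDeriv {E : Type*} [NormedAddCommGroup E] [NormedSpace ℝ E] {n : ℕ}
    (L : Vec n →L[ℝ] E) (A : Fin n → ℕ) (f : E → ℂ) : E → ℂ :=
  (List.finRange n).foldr (fun i g => (dirDeriv (L (Pi.single i 1)))^[A i] g) f

section DirectionalDerivatives

variable {E : Type*} [NormedAddCommGroup E] [NormedSpace ℝ E]

theorem contDiff_dirDeriv (v : E) {f : E → ℂ} (hf : ContDiff ℝ (⊤ : ℕ∞) f) :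
    ContDiff ℝ (⊤ : ℕ∞) (dirDeriv v f) :=
  (hf.fderiv_right (m := ((⊤ : ℕ∞) : WithTop ℕ∞)) (by exact_mod_cast le_top)).clm_apply
    contDiff_const

theorem contDiff_dirDeriv_iterate (v : E) (N : ℕ) {f : E → ℂ}
    (hf : ContDiff ℝ (⊤ : ℕ∞) f) : ContDiff ℝ (⊤ : ℕ∞) ((dirDeriv v)^[N] f) := by
  induction N generalizing f with
  | zero => exact hf
  | succ N ih => exact ih (contDiff_dirDeriv v hf)

theorem dirDeriv_comm (v w : E) {f : E → ℂ} (hf : ContDiff ℝ (⊤ : ℕ∞) f) :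
    dirDeriv v (dirDeriv w f) = dirDeriv w (dirDeriv v f) := by
  have hd : Differentiable ℝ (fderiv ℝ f) :=
    (hf.fderiv_right (m := ((⊤ : ℕ∞) : WithTop ℕ∞)) (by exact_mod_cast le_top)).differentiable
      (by simp)
  have key : ∀ (v w x : E), dirDeriv v (dirDeriv w f) x = fderiv ℝ (fderiv ℝ f) x v w := by
    intro v w x
    have h := ((hd x).hasFDerivAt.clm_apply (hasFDerivAt_const w x)).fderiv
    change fderiv ℝ (fun y => fderiv ℝ f y w) x v = _
    rw [h]
    simp
  funext x
  rw [key, key]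
  exact (hf.contDiffAt.isSymmSndFDerivAt
    (by rw [minSmoothness_of_isRCLikeNormedField]; exact WithTop.coe_le_coe.2 le_top)) v w

theorem dirDeriv_comm_iterate (v w : E) (N : ℕ) {f : E → ℂ} (hf : ContDiff ℝ (⊤ : ℕ∞) f) :
    dirDeriv v ((dirDeriv w)^[N] f) = (dirDeriv w)^[N] (dirDeriv v f) := by
  induction N generalizing f with
  | zero => rfl
  | succ N ih =>
    rw [Function.iterate_succ_apply, ih (contDiff_dirDeriv w hf), dirDeriv_comm v w hf,
      Function.iterate_succ_apply]

theorem contDiff_foldr_dirDeriv {ι : Type*} (l : List ι) (v : ι → E) (A : ι → ℕ) {f : E → ℂ}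
    (hf : ContDiff ℝ (⊤ : ℕ∞) f) :
    ContDiff ℝ (⊤ : ℕ∞) (l.foldr (fun i g => (dirDeriv (v i))^[A i] g) f) := by
  induction l with
  | nil => exact hf
  | cons i l ih => exact contDiff_dirDeriv_iterate _ _ ih

theorem dirDeriv_comm_foldr {ι : Type*} (l : List ι) (v : ι → E) (A : ι → ℕ) (w : E) {f : E → ℂ}
    (hf : ContDiff ℝ (⊤ : ℕ∞) f) :
    dirDeriv w (l.foldr (fun i g => (dirDeriv (v i))^[A i] g) f) =
      l.foldr (fun i g => (dirDeriv (v i))^[A i] g) (dirDeriv w f) := by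
  induction l with
  | nil => rfl
  | cons i l ih =>
    simp only [List.foldr_cons]
    rw [dirDeriv_comm_iterate _ _ _ (contDiff_foldr_dirDeriv l v A hf), ih]

theorem dirDeriv_iterate_comm_foldr {ι : Type*} (l : List ι) (v : ι → E) (A : ι → ℕ) (w : E)
    (N : ℕ) {f : E → ℂ} (hf : ContDiff ℝ (⊤ : ℕ∞) f) :
    (dirDeriv w)^[N] (l.foldr (fun i g => (dirDeriv (v i))^[A i] g) f) =
      l.foldr (fun i g => (dirDeriv (v i))^[A i] g) ((dirDeriv w)^[N] f) := by
  induction N generalizing f with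
  | zero => rfl
  | succ N ih =>
    rw [Function.iterate_succ_apply, dirDeriv_comm_foldr l v A w hf,
      ih (contDiff_dirDeriv w hf), Function.iterate_succ_apply]

theorem foldr_dirDeriv_comm {ι κ : Type*} (l : List ι) (v : ι → E) (A : ι → ℕ)
    (l' : List κ) (w : κ → E) (B : κ → ℕ) {f : E → ℂ} (hf : ContDiff ℝ (⊤ : ℕ∞) f) :
    l.foldr (fun i g => (dirDeriv (v i))^[A i] g)
        (l'.foldr (fun i g => (dirDeriv (w i))^[B i] g) f) =
      l'.foldr (fun i g => (dirDeriv (w i))^[B i] g)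
        (l.foldr (fun i g => (dirDeriv (v i))^[A i] g) f) := by
  induction l with
  | nil => rfl
  | cons i l ih =>
    simp only [List.foldr_cons]
    rw [ih, dirDeriv_iterate_comm_foldr _ _ _ _ _ (contDiff_foldr_dirDeriv l v A hf)]

theorem contDiff_iterDirDeriv {n : ℕ} (L : Vec n →L[ℝ] E) (A : Fin n → ℕ) {f : E → ℂ}
    (hf : ContDiff ℝ (⊤ : ℕ∞) f) : ContDiff ℝ (⊤ : ℕ∞) (iterDirDeriv L A f) :=
  contDiff_foldr_dirDeriv _ _ _ hf

theorem iterDirDeriv_comm {n : ℕ} (L L' : Vec n →L[ℝ] E) (A B : Fin n → ℕ) {f : E → ℂ}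
    (hf : ContDiff ℝ (⊤ : ℕ∞) f) :
    iterDirDeriv L A (iterDirDeriv L' B f) = iterDirDeriv L' B (iterDirDeriv L A f) :=
  foldr_dirDeriv_comm _ _ _ _ _ _ hf

theorem pdC_comp_affine {n : ℕ} (L : Vec n →L[ℝ] E) (c : E) (i : Fin n) {f : E → ℂ}
    (hf : ContDiff ℝ (⊤ : ℕ∞) f) :
    pdC i (fun x => f (c + L x)) = fun x => dirDeriv (L (Pi.single i 1)) f (c + L x) := by
  funext x
  have h1 : HasFDerivAt (fun x => c + L x) L x := L.hasFDerivAt.const_add c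
  have h2 := ((hf.differentiable (by simp)) (c + L x)).hasFDerivAt.comp x h1
  simp only [pdC, dirDeriv]
  rw [show (fun x => f (c + L x)) = f ∘ (fun x => c + L x) from rfl, h2.fderiv]
  rfl

theorem mpd_comp_affine {n : ℕ} (L : Vec n →L[ℝ] E) (c : E) (A : Fin n → ℕ) {f : E → ℂ}
    (hf : ContDiff ℝ (⊤ : ℕ∞) f) :
    mpd A (fun x => f (c + L x)) = fun x => iterDirDeriv L A f (c + L x) := by
  have hiter : ∀ (i : Fin n) (N : ℕ) (g : E → ℂ), ContDiff ℝ (⊤ : ℕ∞) g →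
      (pdC i)^[N] (fun x => g (c + L x)) =
        fun x => (dirDeriv (L (Pi.single i 1)))^[N] g (c + L x) := by
    intro i N
    induction N with
    | zero => intro g _; rfl
    | succ N ih =>
      intro g hg
      rw [Function.iterate_succ_apply, pdC_comp_affine L c i hg, ih _ (contDiff_dirDeriv _ hg)]
      rfl
  unfold mpd iterDirDeriv
  generalize List.finRange n = l
  induction l with
  | nil => rfl
  | cons i l ih =>
    simp only [List.foldr_cons]
    rw [ih, hiter _ _ _ (contDiff_foldr_dirDeriv l (fun i => L (Pi.single i 1)) A hf)]

end DirectionalDerivatives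

section Bisymbols

variable {n : ℕ}

/-- Uncurried form of a function of three vector variables. -/
def uncurryBi (a : Vec n → Vec n → Vec n → ℂ) : Vec n × Vec n × Vec n → ℂ :=
  fun x => a x.1 x.2.1 x.2.2

theorem uncurryBi_injective : Function.Injective (uncurryBi (n := n)) := by
  intro a b h
  funext q p q'
  exact congrFun h (q, p, q')

theorem uncurryBi_d1B (A : Fin n → ℕ) {a : Vec n → Vec n → Vec n → ℂ}
    (ha : ContDiff ℝ (⊤ : ℕ∞) (uncurryBi a)) :
    uncurryBi (d1B A a) =
      iterDirDeriv (ContinuousLinearMap.inl ℝ (Vec n) (Vec n × Vec n)) A (uncurryBi a) := by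
  funext ⟨q, p, q'⟩
  have h := congrFun (mpd_comp_affine (ContinuousLinearMap.inl ℝ (Vec n) (Vec n × Vec n))
    ((0, p, q') : Vec n × Vec n × Vec n) A ha) q
  simpa [uncurryBi, d1B] using h

theorem uncurryBi_d2B (B : Fin n → ℕ) {a : Vec n → Vec n → Vec n → ℂ}
    (ha : ContDiff ℝ (⊤ : ℕ∞) (uncurryBi a)) :
    uncurryBi (d2B B a) =
      iterDirDeriv ((ContinuousLinearMap.inr ℝ (Vec n) (Vec n × Vec n)).comp
        (ContinuousLinearMap.inl ℝ (Vec n) (Vec n))) B (uncurryBi a) := by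
  funext ⟨q, p, q'⟩
  have h := congrFun (mpd_comp_affine ((ContinuousLinearMap.inr ℝ (Vec n) (Vec n × Vec n)).comp
        (ContinuousLinearMap.inl ℝ (Vec n) (Vec n)))
    ((q, 0, q') : Vec n × Vec n × Vec n) B ha) p
  simpa [uncurryBi, d2B] using h

theorem uncurryBi_d3B (A : Fin n → ℕ) {a : Vec n → Vec n → Vec n → ℂ}
    (ha : ContDiff ℝ (⊤ : ℕ∞) (uncurryBi a)) :
    uncurryBi (d3B A a) =
      iterDirDeriv ((ContinuousLinearMap.inr ℝ (Vec n) (Vec n × Vec n)).comp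
        (ContinuousLinearMap.inr ℝ (Vec n) (Vec n))) A (uncurryBi a) := by
  funext ⟨q, p, q'⟩
  have h := congrFun (mpd_comp_affine ((ContinuousLinearMap.inr ℝ (Vec n) (Vec n × Vec n)).comp
        (ContinuousLinearMap.inr ℝ (Vec n) (Vec n)))
    ((q, p, 0) : Vec n × Vec n × Vec n) A ha) q'
  simpa [uncurryBi, d3B] using h

theorem d3B_d2B_d1B_eq (A B A' : Fin n → ℕ) {a : Vec n → Vec n → Vec n → ℂ}
    (ha : ContDiff ℝ (⊤ : ℕ∞) (uncurryBi a)) :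
    d3B A (d2B B (d1B A' a)) = d1B A' (d2B B (d3B A a)) := by
  have h1 : ContDiff ℝ (⊤ : ℕ∞) (uncurryBi (d1B A' a)) := by
    rw [uncurryBi_d1B A' ha]; exact contDiff_iterDirDeriv _ _ ha
  have h21 : ContDiff ℝ (⊤ : ℕ∞) (uncurryBi (d2B B (d1B A' a))) := by
    rw [uncurryBi_d2B B h1]; exact contDiff_iterDirDeriv _ _ h1
  have h3 : ContDiff ℝ (⊤ : ℕ∞) (uncurryBi (d3B A a)) := by
    rw [uncurryBi_d3B A ha]; exact contDiff_iterDirDeriv _ _ ha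
  have h23 : ContDiff ℝ (⊤ : ℕ∞) (uncurryBi (d2B B (d3B A a))) := by
    rw [uncurryBi_d2B B h3]; exact contDiff_iterDirDeriv _ _ h3
  apply uncurryBi_injective
  rw [uncurryBi_d3B A h21, uncurryBi_d2B B h1, uncurryBi_d1B A' ha, uncurryBi_d1B A' h23,
    uncurryBi_d2B B h3, uncurryBi_d3B A ha, iterDirDeriv_comm _ _ B A' ha,
    iterDirDeriv_comm _ _ A A' (contDiff_iterDirDeriv _ _ ha), iterDirDeriv_comm _ _ A B ha]

theorem mpd_conj (A : Fin n → ℕ) (f : Vec n → ℂ) :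
    mpd A (fun x => starRingEnd ℂ (f x)) = fun x => starRingEnd ℂ (mpd A f x) := by
  have hpd : ∀ (i : Fin n) (g : Vec n → ℂ),
      pdC i (fun x => starRingEnd ℂ (g x)) = fun x => starRingEnd ℂ (pdC i g x) := by
    intro i g
    funext x
    have h := Complex.conjCLE.comp_fderiv (f := g) (x := x)
    simp only [pdC]
    rw [show (fun x => starRingEnd ℂ (g x)) = Complex.conjCLE ∘ g from rfl, h]
    rfl
  have hiter : ∀ (i : Fin n) (N : ℕ) (g : Vec n → ℂ),
      (pdC i)^[N] (fun x => starRingEnd ℂ (g x)) =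
        fun x => starRingEnd ℂ ((pdC i)^[N] g x) := by
    intro i N
    induction N with
    | zero => intro g; rfl
    | succ N ih => intro g; rw [Function.iterate_succ_apply, hpd, ih]; rfl
  unfold mpd
  generalize List.finRange n = l
  induction l with
  | nil => rfl
  | cons i l ih => simp only [List.foldr_cons]; rw [ih, hiter]

/-- The formal adjoint bisymbol `a†(q,p,q') = conj (a(q',p,q))`. -/
noncomputable def adjBi (a : Vec n → Vec n → Vec n → ℂ) : Vec n → Vec n → Vec n → ℂ :=
  fun q p q' => starRingEnd ℂ (a q' p q)

theorem d1B_adjBi (A : Fin n → ℕ) (a : Vec n → Vec n → Vec n → ℂ) :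
    d1B A (adjBi a) = adjBi (d3B A a) := by
  funext q p q'
  exact congrFun (mpd_conj A (fun x => a q' p x)) q

theorem d2B_adjBi (A : Fin n → ℕ) (a : Vec n → Vec n → Vec n → ℂ) :
    d2B A (adjBi a) = adjBi (d2B A a) := by
  funext q p q'
  exact congrFun (mpd_conj A (fun x => a q' x q)) p

theorem d3B_adjBi (A : Fin n → ℕ) (a : Vec n → Vec n → Vec n → ℂ) :
    d3B A (adjBi a) = adjBi (d1B A a) := by
  funext q p q'
  exact congrFun (mpd_conj A (fun x => a x p q)) q'

theorem IsBisymbol.adjoint [NeZero n] {lam : ℝ → ℝ} {m σ t : ℝ} {a : Vec n → Vec n → Vec n → ℂ}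
    (ha : IsBisymbol lam m σ t a) : IsBisymbol lam m σ (1 - t) (adjBi a) := by
  refine ⟨?_, fun A B A' => ?_⟩
  · exact Complex.conjCLE.contDiff.comp (ha.1.comp
      (contDiff_snd.snd.prodMk (contDiff_snd.fst.prodMk contDiff_fst)))
  · obtain ⟨C, hC, h⟩ := ha.2 A' B A
    refine ⟨C, hC, fun j k q p q' hq hq' => ?_⟩
    have hl : lamT lam (1 - t) j k = lamT lam t k j := by
      unfold lamT; congr 1; ring
    have hD : ‖d1B A (d2B B (d3B A' (adjBi a))) q p q'‖
        = ‖d1B A' (d2B B (d3B A a)) q' p q‖ := by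
      rw [d3B_adjBi, d2B_adjBi, d1B_adjBi, d3B_d2B_d1B_eq A B A' ha.1]
      exact Complex.norm_conj _
    rw [hl, hD, sub_right_comm]
    exact h k j q' p q hq' hq

end Bisymbols

section OscillatoryIntegrals

variable {E : Type*} [NormedAddCommGroup E] [NormedSpace ℝ E]

theorem dirDeriv_iterate_add (v : E) (N : ℕ) {f g : E → ℂ} (hf : ContDiff ℝ (⊤ : ℕ∞) f)
    (hg : ContDiff ℝ (⊤ : ℕ∞) g) :
    (dirDeriv v)^[N] (fun x => f x + g x) =
      fun x => (dirDeriv v)^[N] f x + (dirDeriv v)^[N] g x := by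
  induction N generalizing f g with
  | zero => rfl
  | succ N ih =>
    have h : dirDeriv v (fun x => f x + g x) = fun x => dirDeriv v f x + dirDeriv v g x := by
      funext x
      simp only [dirDeriv]
      rw [fderiv_fun_add (hf.differentiable (by simp) x) (hg.differentiable (by simp) x)]
      rfl
    rw [Function.iterate_succ_apply, h, ih (contDiff_dirDeriv v hf) (contDiff_dirDeriv v hg)]
    rfl

theorem dirDeriv_mul (v : E) {f g : E → ℂ} (hf : ContDiff ℝ (⊤ : ℕ∞) f)
    (hg : ContDiff ℝ (⊤ : ℕ∞) g) :
    dirDeriv v (fun x => f x * g x) = fun x => dirDeriv v f x * g x + f x * dirDeriv v g x := by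
  funext x
  simp only [dirDeriv]
  rw [fderiv_fun_mul (hf.differentiable (by simp) x) (hg.differentiable (by simp) x)]
  simp [mul_comm, add_comm]

theorem norm_dirDeriv_iterate_mul_le (v x : E) (N : ℕ) {f g : E → ℂ} {M K : ℝ}
    (hf : ContDiff ℝ (⊤ : ℕ∞) f) (hg : ContDiff ℝ (⊤ : ℕ∞) g)
    (hM : ∀ m ≤ N, ‖(dirDeriv v)^[m] f x‖ ≤ M) (hK : ∀ m ≤ N, ‖(dirDeriv v)^[m] g x‖ ≤ K) :
    ‖(dirDeriv v)^[N] (fun x => f x * g x) x‖ ≤ 2 ^ N * (M * K) := by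
  induction N generalizing f g with
  | zero =>
    have h1 := hM 0 le_rfl
    have h2 := hK 0 le_rfl
    simp only [Function.iterate_zero, id_eq, pow_zero, one_mul, norm_mul] at h1 h2 ⊢
    exact mul_le_mul h1 h2 (norm_nonneg _) ((norm_nonneg _).trans h1)
  | succ N ih =>
    have hf' := contDiff_dirDeriv v hf
    have hg' := contDiff_dirDeriv v hg
    rw [Function.iterate_succ_apply, dirDeriv_mul v hf hg,
      dirDeriv_iterate_add v N (hf'.mul hg) (hf.mul hg')]
    have h1 := ih hf' hg (fun m hm => hM (m + 1) (by omega)) (fun m hm => hK m (by omega))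
    have h2 := ih hf hg' (fun m hm => hM m (by omega)) (fun m hm => hK (m + 1) (by omega))
    calc _ ≤ _ := norm_add_le _ _
      _ ≤ 2 ^ N * (M * K) + 2 ^ N * (M * K) := add_le_add h1 h2
      _ = 2 ^ (N + 1) * (M * K) := by ring

theorem tsupport_dirDeriv_iterate_subset (v : E) (N : ℕ) (f : E → ℂ) :
    tsupport ((dirDeriv v)^[N] f) ⊆ tsupport f := by
  induction N generalizing f with
  | zero => rfl
  | succ N ih =>
    exact (ih (dirDeriv v f)).trans (tsupport_fderiv_apply_subset ℝ v)

variable {n : ℕ}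

theorem contDiff_phase (p q : Vec n) : ContDiff ℝ (⊤ : ℕ∞) (phase p q) := by
  have h : ContDiff ℝ (⊤ : ℕ∞) (fun x : Vec n => ∑ i, p i * (q i - x i)) := by fun_prop
  exact Complex.contDiff_exp.comp (contDiff_const.mul (Complex.ofRealCLM.contDiff.comp h))

theorem continuous_phase :
    Continuous (fun z : Vec n × Vec n × Vec n => phase z.1 z.2.1 z.2.2) := by
  unfold phase
  fun_prop

theorem norm_phase (p q x : Vec n) : ‖phase p q x‖ = 1 := by
  rw [phase, mul_comm, Complex.norm_exp_ofReal_mul_I]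

theorem conj_phase (p q x : Vec n) : starRingEnd ℂ (phase p q x) = phase p x q := by
  simp only [phase, ← Complex.exp_conj, map_mul, Complex.conj_I, Complex.conj_ofReal]
  congr 1
  rw [neg_mul, ← mul_neg, ← Complex.ofReal_neg, ← Finset.sum_neg_distrib]
  congr 3
  funext i
  ring

theorem fderiv_phase_single (p q x : Vec n) (i : Fin n) :
    fderiv ℝ (phase p q) x (Pi.single i 1) = -(Complex.I * p i) * phase p q x := by
  rw [← ((contDiff_phase p q).differentiable (by simp) x).lineDeriv_eq_fderiv]
  refine HasLineDerivAt.lineDeriv ?_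
  have h : (fun t : ℝ => phase p q (x + t • Pi.single i 1)) =
      fun t : ℝ => phase p q x * Complex.exp ((t : ℂ) * (-(Complex.I * p i))) := by
    funext t
    simp only [phase, ← Complex.exp_add]
    congr 1
    have : ∑ l, p l * (q l - (x + t • (Pi.single i 1 : Vec n)) l)
        = (∑ l, p l * (q l - x l)) - t * p i := by
      have h1 : ∀ l, p l * (q l - (x + t • (Pi.single i 1 : Vec n)) l)
          = p l * (q l - x l) - (if l = i then t * p i else 0) := by
        intro l
        by_cases hl : l = i
        · subst hl; simp; ring
        · simp [hl]
      rw [Finset.sum_congr rfl fun l _ => h1 l, Finset.sum_sub_distrib]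
      simp
    rw [this]
    push_cast
    ring
  unfold HasLineDerivAt
  rw [h]
  have h2 : HasDerivAt (fun t : ℝ => (t : ℂ) * (-(Complex.I * p i))) (-(Complex.I * p i)) 0 := by
    simpa using (Complex.ofRealCLM.hasDerivAt (x := (0 : ℝ))).mul_const (-(Complex.I * p i))
  have h3 := (h2.cexp).const_mul (phase p q x)
  simpa [mul_comm] using h3

theorem integral_dirDeriv_mul_phase (p q : Vec n) (i : Fin n) {f : Vec n → ℂ}
    (hf : ContDiff ℝ (⊤ : ℕ∞) f) (hfc : HasCompactSupport f) :
    ∫ x, dirDeriv (Pi.single i 1) f x * phase p q x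
      = Complex.I * p i * ∫ x, f x * phase p q x := by
  have hph := contDiff_phase p q
  have hf' := contDiff_dirDeriv (Pi.single i 1) hf
  have hfc' : HasCompactSupport (dirDeriv (Pi.single i (1 : ℝ)) f) :=
    hfc.of_isClosed_subset (isClosed_tsupport _)
      (tsupport_dirDeriv_iterate_subset (Pi.single i 1) 1 f)
  have h := integral_mul_fderiv_eq_neg_fderiv_mul_of_integrable (μ := volume) (f := f)
    (g := phase p q) (v := Pi.single i (1 : ℝ))
    ((hf'.continuous.mul hph.continuous).integrable_of_hasCompactSupport hfc'.mul_right)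
    ((hf.continuous.mul (contDiff_dirDeriv (Pi.single i 1)
      hph).continuous).integrable_of_hasCompactSupport hfc.mul_right)
    ((hf.continuous.mul hph.continuous).integrable_of_hasCompactSupport hfc.mul_right)
    (fun x _ => hf.differentiable (by simp) x) (fun x _ => hph.differentiable (by simp) x)
  simp only [dirDeriv]
  rw [eq_neg_iff_add_eq_zero, add_comm, ← eq_neg_iff_add_eq_zero] at h
  rw [h, ← integral_neg, ← integral_const_mul]
  congr 1
  funext x
  rw [fderiv_phase_single]
  ring

theorem integral_dirDeriv_iterate_mul_phase (p q : Vec n) (i : Fin n) (N : ℕ) {f : Vec n → ℂ}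
    (hf : ContDiff ℝ (⊤ : ℕ∞) f) (hfc : HasCompactSupport f) :
    ∫ x, (dirDeriv (Pi.single i 1))^[N] f x * phase p q x
      = (Complex.I * p i) ^ N * ∫ x, f x * phase p q x := by
  induction N with
  | zero => simp
  | succ N ih =>
    rw [Function.iterate_succ_apply', integral_dirDeriv_mul_phase p q i
      (contDiff_dirDeriv_iterate _ N hf) (hfc.of_isClosed_subset (isClosed_tsupport _)
      (tsupport_dirDeriv_iterate_subset (Pi.single i 1) N f)), ih]
    ring

theorem abs_pow_mul_norm_integral_phase_le (p q : Vec n) (i : Fin n) (N : ℕ) {f : Vec n → ℂ}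
    {K : Set (Vec n)} {M : ℝ} (hf : ContDiff ℝ (⊤ : ℕ∞) f) (hK : IsCompact K)
    (hfK : tsupport f ⊆ K) (hM : ∀ x ∈ K, ‖(dirDeriv (Pi.single i 1))^[N] f x‖ ≤ M) :
    |p i| ^ N * ‖∫ x, f x * phase p q x‖ ≤ M * volume.real K := by
  have h := integral_dirDeriv_iterate_mul_phase p q i N hf
    (hK.of_isClosed_subset (isClosed_tsupport _) hfK)
  have h1 := congrArg norm h
  rw [norm_mul, norm_pow, norm_mul, Complex.norm_I, one_mul, Complex.norm_real,
    Real.norm_eq_abs] at h1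
  rw [← h1, ← setIntegral_eq_integral_of_forall_compl_eq_zero (s := K)]
  · refine norm_setIntegral_le_of_norm_le_const hK.measure_lt_top fun x hx => ?_
    rw [norm_mul, norm_phase, mul_one]
    exact hM x hx
  · intro x hx
    rw [image_eq_zero_of_notMem_tsupport
      (fun h => hx (hfK (tsupport_dirDeriv_iterate_subset _ N f h))), zero_mul]

theorem mpd_zero (f : Vec n → ℂ) : mpd 0 f = f := by
  unfold mpd
  generalize List.finRange n = l
  induction l with
  | nil => rfl
  | cons i l ih => exact ih

theorem mpd_single (i : Fin n) (m : ℕ) (f : Vec n → ℂ) :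
    mpd (Pi.single i m) f = (pdC i)^[m] f := by
  have h : ∀ l : List (Fin n), l.Nodup →
      l.foldr (fun j g => (pdC j)^[(Pi.single i m : Fin n → ℕ) j] g) f
        = if i ∈ l then (pdC i)^[m] f else f := by
    intro l
    induction l with
    | nil => intro _; rfl
    | cons j l ih =>
      intro hl
      rw [List.nodup_cons] at hl
      rw [List.foldr_cons, ih hl.2]
      by_cases hj : j = i
      · subst hj
        simp [hl.1]
      · simp [hj, Ne.symm hj]
  rw [mpd, h _ (List.nodup_finRange n), if_pos (List.mem_finRange i)]

theorem integrable_inv_one_add_norm_pow :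
    Integrable (fun p : Vec n => ((1 + ‖p‖) ^ (n + 1))⁻¹) := by
  have h := integrable_one_add_norm (E := Vec n) (μ := volume) (r := ((n + 1 : ℕ) : ℝ)) (by simp)
  refine h.congr (Filter.Eventually.of_forall fun p => ?_)
  simp only
  rw [Real.rpow_neg (by positivity), Real.rpow_natCast]

variable [NeZero n] {lam : ℝ → ℝ} {t : ℝ} {a : Vec n → Vec n → Vec n → ℂ}

theorem IsBisymbol.exists_norm_pdC_iterate_le (ha : IsBisymbol lam 0 0 t a)
    (hlam : ∀ r, 0 < lam r) (j k : ℤ) (i : Fin n) (m : ℕ) :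
    ∃ C, 0 ≤ C ∧ ∀ q p x : Vec n, |q 0 - j| ≤ 1 → |x 0 - k| ≤ 1 →
      ‖(pdC i)^[m] (a q p) x‖ ≤ C := by
  obtain ⟨C, hC, h⟩ := ha.2 0 0 (Pi.single i m)
  have hpos : 0 < lamT lam t j k ^ ((angLen (0 : Fin n → ℕ) : ℤ) - (angLen (0 : Fin n → ℕ) : ℤ)
      - (angLen (Pi.single i m : Fin n → ℕ) : ℤ)) := zpow_pos (hlam _) _
  refine ⟨C / _, (div_pos hC hpos).le, fun q p x hq hx => ?_⟩
  have h1 := h j k q p x hq hx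
  simp only [d1B, d2B, d3B, mpd_zero, mpd_single] at h1
  rw [le_div_iff₀ hpos, mul_comm]
  simpa using h1

theorem IsBisymbol.contDiff_right (ha : IsBisymbol lam 0 0 t a) (q p : Vec n) :
    ContDiff ℝ (⊤ : ℕ∞) (a q p) :=
  ha.1.comp (contDiff_const.prodMk (contDiff_const.prodMk contDiff_id))

theorem IsBisymbol.exists_norm_integral_le (ha : IsBisymbol lam 0 0 t a)
    (hlam : ∀ r, 0 < lam r) (j k : ℤ) {w : Vec n → ℂ} (hw : ContDiff ℝ (⊤ : ℕ∞) w)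
    (hwc : HasCompactSupport w) (hwk : ∀ x ∈ tsupport w, |x 0 - k| ≤ 1) (N : ℕ) :
    ∃ C, ∀ q p : Vec n, |q 0 - j| ≤ 1 →
      ‖∫ x, a q p x * phase p q x * w x‖ ≤ C * ((1 + ‖p‖) ^ N)⁻¹ := by
  choose D hD0 hD using ha.exists_norm_pdC_iterate_le hlam j k
  have hw' : ∀ (i : Fin n) (m : ℕ), ∃ C, ∀ x, ‖(pdC i)^[m] w x‖ ≤ C := fun i m =>
    HasCompactSupport.exists_bound_of_continuous
      (hwc.of_isClosed_subset (isClosed_tsupport _)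
        (tsupport_dirDeriv_iterate_subset (Pi.single i 1) m w))
      (contDiff_dirDeriv_iterate (Pi.single i 1) m hw).continuous
  choose W hW using hw'
  have hW0 : ∀ i m, 0 ≤ W i m := fun i m => (norm_nonneg _).trans (hW i m 0)
  set DD : ℝ := ∑ i, ∑ m ∈ Finset.range (N + 1), D i m with hDD
  set WW : ℝ := ∑ i, ∑ m ∈ Finset.range (N + 1), W i m with hWW
  have hle : ∀ (T : Fin n → ℕ → ℝ), (∀ i m, 0 ≤ T i m) → ∀ i, ∀ m ≤ N,
      T i m ≤ ∑ i, ∑ m ∈ Finset.range (N + 1), T i m := by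
    intro T hT i m hm
    calc T i m ≤ ∑ m ∈ Finset.range (N + 1), T i m :=
          Finset.single_le_sum (f := fun m => T i m) (fun m _ => hT i m)
            (Finset.mem_range.2 (by omega))
      _ ≤ _ := Finset.single_le_sum (f := fun i => ∑ m ∈ Finset.range (N + 1), T i m)
            (fun i _ => Finset.sum_nonneg fun m _ => hT i m) (Finset.mem_univ i)
  set B : ℝ := 2 ^ N * (DD * WW) * volume.real (tsupport w) with hB
  refine ⟨2 ^ N * B, fun q p hq => ?_⟩
  have hsm : ContDiff ℝ (⊤ : ℕ∞) (fun x => a q p x * w x) := (ha.contDiff_right q p).mul hw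
  have key : ∀ (i : Fin n), ∀ m ≤ N,
      |p i| ^ m * ‖∫ x, a q p x * phase p q x * w x‖ ≤ B := by
    intro i m hm
    have h := abs_pow_mul_norm_integral_phase_le p q i m (M := 2 ^ N * (DD * WW)) hsm hwc
      (tsupport_mul_subset_right) ?_
    · simpa only [mul_right_comm] using h
    · intro x hx
      refine (norm_dirDeriv_iterate_mul_le (M := DD) (K := WW) (Pi.single i 1) x m
        (ha.contDiff_right q p) hw (fun l hl => ?_) (fun l hl => ?_)).trans ?_
      · exact (hD i l q p x hq (hwk x hx)).trans (hle D hD0 i l (hl.trans hm))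
      · exact (hW i l x).trans (hle W hW0 i l (hl.trans hm))
      · have h1 : 0 ≤ DD * WW := mul_nonneg
          (Finset.sum_nonneg fun i _ => Finset.sum_nonneg fun m _ => hD0 i m)
          (Finset.sum_nonneg fun i _ => Finset.sum_nonneg fun m _ => hW0 i m)
        gcongr
        norm_num
  obtain ⟨i, hi⟩ := Finite.exists_max fun l => |p l|
  have hp : ‖p‖ ≤ |p i| := (pi_norm_le_iff_of_nonneg (abs_nonneg _)).2 hi
  have h0 := key i 0 (Nat.zero_le _)
  have hN := key i N le_rfl
  rw [pow_zero, one_mul] at h0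
  rw [← div_eq_mul_inv, le_div_iff₀ (by positivity)]
  set J := ‖∫ x, a q p x * phase p q x * w x‖
  have hJ : 0 ≤ J := norm_nonneg _
  rcases le_total |p i| 1 with h1 | h1
  · calc J * (1 + ‖p‖) ^ N ≤ J * 2 ^ N := by gcongr; linarith
      _ ≤ 2 ^ N * B := by rw [mul_comm]; gcongr
  · calc J * (1 + ‖p‖) ^ N ≤ J * (2 * |p i|) ^ N := by gcongr; linarith
      _ = 2 ^ N * (|p i| ^ N * J) := by rw [mul_pow]; ring
      _ ≤ 2 ^ N * B := by gcongr

theorem IsBisymbol.integral_mul_integral_swap (ha : IsBisymbol lam 0 0 t a)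
    (hlam : ∀ r, 0 < lam r) (j k : ℤ) {V w : Vec n → ℂ} (hV : Continuous V)
    (hVc : HasCompactSupport V) (hVj : ∀ q ∈ tsupport V, |q 0 - j| ≤ 1)
    (hw : ContDiff ℝ (⊤ : ℕ∞) w)
    (hwc : HasCompactSupport w) (hwk : ∀ x ∈ tsupport w, |x 0 - k| ≤ 1) :
    ∫ q, V q * ∫ p, ∫ x, a q p x * phase p q x * w x
      = ∫ p, ∫ q, ∫ x, V q * (a q p x * phase p q x * w x) := by
  obtain ⟨C, hC⟩ := ha.exists_norm_integral_le hlam j k hw hwc hwk (n + 1)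
  have hmeas : StronglyMeasurable
      (fun z : Vec n × Vec n => ∫ x, V z.1 * (a z.1 z.2 x * phase z.2 z.1 x * w x)) := by
    refine StronglyMeasurable.integral_prod_right (Continuous.stronglyMeasurable ?_)
    have h1 := ha.1.continuous.comp ((continuous_fst.comp continuous_fst).prodMk
      ((continuous_snd.comp continuous_fst).prodMk continuous_snd) :
        Continuous fun z : (Vec n × Vec n) × Vec n => (z.1.1, z.1.2, z.2))
    have h2 := continuous_phase.comp ((continuous_snd.comp continuous_fst).prodMk
      ((continuous_fst.comp continuous_fst).prodMk continuous_snd) :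
        Continuous fun z : (Vec n × Vec n) × Vec n => (z.1.2, z.1.1, z.2))
    exact (hV.comp (continuous_fst.comp continuous_fst)).mul
      ((h1.mul h2).mul (hw.continuous.comp continuous_snd))
  simp only [← integral_const_mul]
  refine integral_integral_swap (f := fun q p => ∫ x, V q * (a q p x * phase p q x * w x)) ?_
  refine Integrable.mono' ((hV.integrable_of_hasCompactSupport hVc).norm.mul_prod
    (integrable_inv_one_add_norm_pow.const_mul C)) hmeas.aestronglyMeasurable
    (Filter.Eventually.of_forall fun z => ?_)
  simp only [Function.uncurry, integral_const_mul, norm_mul]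
  by_cases hz : z.1 ∈ tsupport V
  · exact mul_le_mul_of_nonneg_left (hC z.1 z.2 (hVj _ hz)) (norm_nonneg _)
  · simp [image_eq_zero_of_notMem_tsupport hz]

theorem IsBisymbol.integral_adjBi_eq (ha : IsBisymbol lam 0 0 t a)
    (hlam : ∀ r, 0 < lam r) (j k : ℤ) {V U : Vec n → ℂ} (hV : ContDiff ℝ (⊤ : ℕ∞) V)
    (hVc : HasCompactSupport V) (hVj : ∀ q ∈ tsupport V, |q 0 - j| ≤ 1)
    (hU : ContDiff ℝ (⊤ : ℕ∞) U)
    (hUc : HasCompactSupport U) (hUk : ∀ x ∈ tsupport U, |x 0 - k| ≤ 1) :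
    ∫ q, U q * starRingEnd ℂ (∫ p, ∫ x, adjBi a q p x * phase p q x * V x)
      = ∫ q, starRingEnd ℂ (V q) * ∫ p, ∫ x, a q p x * phase p q x * U x := by
  have hsupp : ∀ f : Vec n → ℂ, tsupport (fun x => starRingEnd ℂ (f x)) = tsupport f := by
    intro f
    unfold tsupport
    congr 1
    ext x
    simp
  have hconj : ∀ f : Vec n → ℂ, HasCompactSupport f →
      HasCompactSupport (fun x => starRingEnd ℂ (f x)) := by
    intro f hf
    unfold HasCompactSupport
    rwa [hsupp]
  have h1 := ha.integral_mul_integral_swap hlam j k (V := fun x => starRingEnd ℂ (V x))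
    (Complex.continuous_conj.comp hV.continuous) (hconj V hVc) (by rwa [hsupp]) hU hUc hUk
  have h2 := ha.adjoint.integral_mul_integral_swap hlam k j (V := fun x => starRingEnd ℂ (U x))
    (Complex.continuous_conj.comp hU.continuous) (hconj U hUc) (by rwa [hsupp]) hV hVc hVj
  rw [h1]
  have h3 := congrArg (starRingEnd ℂ) h2
  simp only [← integral_conj, map_mul, Complex.conj_conj, conj_phase,
    adjBi] at h3
  simp only [← integral_conj, map_mul, Complex.conj_conj, conj_phase, adjBi]
  rw [h3]
  congr 1
  funext p
  rw [integral_integral_swap]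
  · congr 1
    funext q
    congr 1
    funext x
    ring
  · have hcont : Continuous (Function.uncurry fun q x : Vec n =>
        U q * (a x p q * phase p x q * starRingEnd ℂ (V x))) := by
      have h1 := ha.1.continuous.comp (continuous_snd.prodMk
        (continuous_const.prodMk continuous_fst) :
          Continuous fun z : Vec n × Vec n => (z.2, p, z.1))
      have h2 := continuous_phase.comp (continuous_const.prodMk
        (continuous_snd.prodMk continuous_fst) :
          Continuous fun z : Vec n × Vec n => (p, z.2, z.1))
      exact (hU.continuous.comp continuous_fst).mul ((h1.mul h2).mul
        (Complex.continuous_conj.comp (hV.continuous.comp continuous_snd)))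
    refine hcont.integrable_of_hasCompactSupport
      (HasCompactSupport.intro (hUc.prod hVc) fun z hz => ?_)
    simp only [Set.mem_prod, not_and_or] at hz
    rcases hz with hz | hz <;> simp [Function.uncurry, image_eq_zero_of_notMem_tsupport hz]

end OscillatoryIntegrals

theorem contDiff_cutoff_mul {n : ℕ} [NeZero n] {ψ : ℝ → ℝ} (hψ : ContDiff ℝ (⊤ : ℕ∞) ψ) (c : ℝ)
    {u : Vec n → ℂ} (hu : ContDiff ℝ (⊤ : ℕ∞) u) :
    ContDiff ℝ (⊤ : ℕ∞) (fun q : Vec n => (ψ (q 0 - c) : ℂ) * u q) :=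
  (Complex.ofRealCLM.contDiff.comp (hψ.comp ((contDiff_apply ℝ ℝ 0).sub contDiff_const))).mul hu

theorem abs_sub_le_of_mem_tsupport_cutoff_mul {n : ℕ} [NeZero n] {ψ : ℝ → ℝ}
    (hψ : tsupport ψ ⊆ Set.Ioo (-1 : ℝ) 1) (c : ℝ) (u : Vec n → ℂ) :
    ∀ q ∈ tsupport (fun q : Vec n => (ψ (q 0 - c) : ℂ) * u q), |q 0 - c| ≤ 1 := by
  have hclosed : IsClosed {q : Vec n | |q 0 - c| ≤ 1} :=
    isClosed_le (by fun_prop) continuous_const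
  refine closure_minimal (fun q hq => ?_) hclosed
  have h : ψ (q 0 - c) ≠ 0 := by
    intro h
    simp [h] at hq
  have := hψ (subset_tsupport ψ h)
  exact abs_le.2 ⟨this.1.le, this.2.le⟩

/-- **Lemma 3.5.**  Let `λ` satisfy the admissibility condition, and let `ψ` be the
partition-of-unity function.  If `a ∈ BS^m_σ(λ;t)` then
`a†(q,p,q') := conj (a(q',p,q))` belongs to `BS^m_σ(λ;1-t)`.  Moreover, for
`a ∈ BS⁰₀(λ;t)` and `j, k ∈ ℤ`, the (bounded) operator `ψ_j Op(a) ψ_k` on `L²(dq)` has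
adjoint given on `C_c^∞(ℝⁿ)` by `ψ_k Op(a†) ψ_j`, i.e.
`⟪(ψ_k Op(a†) ψ_j) v, u⟫_{L²} = ⟪v, (ψ_j Op(a) ψ_k) u⟫_{L²}` for test functions `u, v`. -/
theorem Op_formal_adjoint
    (n : ℕ) [NeZero n] (lam : ℝ → ℝ) (hlam : Admissible lam)
    (ψ : ℝ → ℝ) (hψ : ContDiff ℝ (⊤ : ℕ∞) ψ) (hψsupp : tsupport ψ ⊆ Set.Ioo (-1 : ℝ) 1)
    (hψpos : ∀ r, 0 ≤ ψ r) (hψsum : ∀ r : ℝ, ∑' j : ℤ, ψ (r - j) = 1) :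
    (∀ m σ : ℝ, σ ∈ Set.Icc (0 : ℝ) 1 → ∀ t ∈ Set.Icc (0 : ℝ) 1,
      ∀ a : Vec n → Vec n → Vec n → ℂ, IsBisymbol lam m σ t a →
        IsBisymbol lam m σ (1 - t) (fun q p q' => starRingEnd ℂ (a q' p q))) ∧
    (∀ t ∈ Set.Icc (0 : ℝ) 1, ∀ a : Vec n → Vec n → Vec n → ℂ, IsBisymbol lam 0 0 t a →
      ∀ j k : ℤ, ∀ u v : Vec n → ℂ,
        ContDiff ℝ (⊤ : ℕ∞) u → HasCompactSupport u → ContDiff ℝ (⊤ : ℕ∞) v → HasCompactSupport v →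
        ∫ q : Vec n, starRingEnd ℂ
              ((ψ (q 0 - k) : ℂ) *
                Op (fun x p x' => starRingEnd ℂ (a x' p x))
                  (fun q' => (ψ (q' 0 - j) : ℂ) * v q') q) * u q
          = ∫ q : Vec n, starRingEnd ℂ (v q) *
              ((ψ (q 0 - j) : ℂ) * Op a (fun q' => (ψ (q' 0 - k) : ℂ) * u q') q)) := by
  refine ⟨fun m σ _ t _ a ha => ha.adjoint, fun t _ a ha j k u v hu huc hv hvc => ?_⟩
  have h := ha.integral_adjBi_eq hlam.1 j k (contDiff_cutoff_mul hψ j hv) hvc.mul_left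
    (abs_sub_le_of_mem_tsupport_cutoff_mul hψsupp j v) (contDiff_cutoff_mul hψ k hu) huc.mul_left
    (abs_sub_le_of_mem_tsupport_cutoff_mul hψsupp k u)
  have h' := congrArg (fun z => (((2 * Real.pi) ^ (-(n : ℤ)) : ℝ) : ℂ) * z) h
  simp only [← integral_const_mul (((2 * Real.pi) ^ (-(n : ℤ)) : ℝ) : ℂ)] at h'
  refine Eq.trans ?_ (h'.trans ?_)
  · congr 1
    funext q
    simp only [Op, adjBi, map_mul, Complex.conj_ofReal]
    ring
  · congr 1
    funext q
    simp only [Op, map_mul, Complex.conj_ofReal]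
    ring
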